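/- Let q = 2ⁿ for some positive integer n, and let N_q be the number of permutation rational functions of degree 3 of the form f/g with f, g ∈ F_q[x] monic coprime polynomials. Let m ∈ {1, 2} be the residue class of q modulo 3. Then N_q = (1/2)(q⁴ + 2(m − 1)q³ + (2m − 3)q²). -/

import Mathlib

open Polynomial

noncomputable section

open scoped Classical in
/-- The self-map of `ℙ¹(F) = F ∪ {∞}` (encoded as `Option F`, with `none` = `∞`)
induced by the rational function `f/g`, where `f, g` are coprime polynomials. -/
def ratEval {F : Type} [Field F] (f g : F[X]) : Option F → Option F := fun x =>
  match x with
  | some a => if g.eval a ≠ 0 then some (f.eval a / g.eval a) else none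
  | none =>
      if g.natDegree < f.natDegree then none
      else if f.natDegree < g.natDegree then some 0
      else some (f.leadingCoeff / g.leadingCoeff)

/-- The set of pairs of monic coprime polynomials `(f, g)` with `max(deg f, deg g) = 3`
such that `f/g` is a permutation rational function. -/
def permPairs (F : Type) [Field F] : Set (F[X] × F[X]) :=
  {p | p.1.Monic ∧ p.2.Monic ∧ IsCoprime p.1 p.2 ∧
    max p.1.natDegree p.2.natDegree = 3 ∧ Function.Bijective (ratEval p.1 p.2)}

theorem splits_X_pow_card_sub_X (F : Type*) [Field F] [Fintype F] :
    ((X : F[X]) ^ Fintype.card F - X).Splits := by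
  rw [splits_iff_card_roots, FiniteField.roots_X_pow_card_sub_X,
    FiniteField.X_pow_card_sub_X_natDegree_eq _ Fintype.one_lt_card]
  rfl

theorem mem_range_algebraMap_of_pow_card_eq {F K : Type*} [Field F] [Fintype F] [Field K]
    [Algebra F K] {θ : K} (hθ : θ ^ Fintype.card F = θ) : θ ∈ Set.range (algebraMap F K) := by
  have hmem : θ ∈ (((X : F[X]) ^ Fintype.card F - X).map (algebraMap F K)).roots := by
    rw [mem_roots (Polynomial.map_ne_zero
      (FiniteField.X_pow_card_sub_X_ne_zero F Fintype.one_lt_card))]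
    simp [hθ]
  rw [(splits_X_pow_card_sub_X F).roots_map, FiniteField.roots_X_pow_card_sub_X] at hmem
  simpa using hmem

theorem sum_one_div_sub_algebraMap {F K : Type*} [Field F] [Fintype F] [Field K] [Algebra F K]
    {θ : K} (hθ : θ ^ Fintype.card F ≠ θ) :
    ∑ x : F, 1 / (θ - algebraMap F K x) = -1 / (θ ^ Fintype.card F - θ) := by
  have hs := splits_X_pow_card_sub_X F
  have key := (hs.map (algebraMap F K)).eval_derivative_div_eval_of_ne_zero (x := θ)
    (by simpa [sub_eq_zero] using hθ)
  rw [hs.roots_map, FiniteField.roots_X_pow_card_sub_X] at key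
  have hq : ((Fintype.card F : ℕ) : K) = 0 := by
    rw [← map_natCast (algebraMap F K), Nat.cast_card_eq_zero, map_zero]
  simpa [hq, derivative_X_pow] using key.symm

theorem div_quadratic_eq_of_root {K : Type*} [Field K] [CharP K 2] {θ t e d : K}
    (hθ : θ ^ 2 + e * θ + d = 0) (ht : t ^ 2 + e * t + d ≠ 0) :
    t / (t ^ 2 + e * t + d) = 1 / (θ - t) + (θ + e) * (1 / (t ^ 2 + e * t + d)) := by
  have hne : θ - t ≠ 0 := by
    intro h
    rw [sub_eq_zero.1 h] at hθ
    exact ht hθ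
  generalize hG : t ^ 2 + e * t + d = G at ht ⊢
  field_simp
  linear_combination hG - hθ + (t * θ - t ^ 2) * CharTwo.two_eq_zero (R := K)

theorem sum_eq_zero_of_add_right_invariant {F : Type*} [Field F] [Fintype F] [CharP F 2] {e : F}
    (he : e ≠ 0) {u : F → F} (hu : ∀ x, u (x + e) = u x) : ∑ x, u x = 0 := by
  refine Finset.sum_involution (fun x _ => x + e) ?_ ?_ ?_ ?_
  · intro x _
    rw [hu, CharTwo.add_self_eq_zero]
  · intro x _ _ h
    exact he (by simpa using h)
  · simp
  · intro x _
    exact CharTwo.add_cancel_right x e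

section
variable {F : Type*} [Field F] [Fintype F] [CharP F 2] {e d : F}

theorem linear_coeff_ne_zero (hg : ∀ x : F, x ^ 2 + e * x + d ≠ 0) : e ≠ 0 := by
  rintro rfl
  obtain ⟨r, hr⟩ := (Finite.injective_iff_surjective.1 (CharTwo.sq_injective (R := F))) d
  apply hg r
  simp only at hr
  rw [hr, zero_mul, add_zero, CharTwo.add_self_eq_zero]

theorem sum_one_div_quadratic (hg : ∀ x : F, x ^ 2 + e * x + d ≠ 0) (k : ℕ) :
    ∑ x : F, 1 / (x ^ 2 + e * x + d) ^ k = 0 := by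
  refine sum_eq_zero_of_add_right_invariant (linear_coeff_ne_zero hg) fun x => ?_
  congr 2
  linear_combination (e * x + e ^ 2) * CharTwo.two_eq_zero (R := F)

theorem sum_div_quadratic (hg : ∀ x : F, x ^ 2 + e * x + d ≠ 0) :
    ∑ x : F, x / (x ^ 2 + e * x + d) = 1 / e := by
  have he := linear_coeff_ne_zero hg
  let K := AlgebraicClosure F
  have : CharP K 2 := charP_of_injective_algebraMap (algebraMap F K).injective 2
  have h2 : (2 : K) = 0 := CharTwo.two_eq_zero
  obtain ⟨θ, hθ⟩ := IsAlgClosed.exists_root (k := K)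
    ((X ^ 2 + C e * X + C d : F[X]).map (algebraMap F K)) (by
      rw [degree_map]
      have : (X ^ 2 + C e * X + C d : F[X]).degree = 2 := by compute_degree!
      rw [this]; norm_num)
  replace hθ : θ ^ 2 + algebraMap F K e * θ + algebraMap F K d = 0 := by simpa using hθ
  have hne : θ ^ Fintype.card F ≠ θ := by
    intro h
    obtain ⟨x, rfl⟩ := mem_range_algebraMap_of_pow_card_eq h
    apply hg x
    apply (algebraMap F K).injective
    simpa using hθ
  have hfrob : (θ ^ Fintype.card F) ^ 2 + algebraMap F K e * θ ^ Fintype.card F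
      + algebraMap F K d = 0 := by
    have := congrArg (FiniteField.frobeniusAlgHom F K) hθ
    rwa [map_add, map_add, map_mul, map_pow, AlgHom.commutes, AlgHom.commutes, map_zero,
      FiniteField.coe_frobeniusAlgHom] at this
  have hsum : θ ^ Fintype.card F - θ = algebraMap F K e := by
    have : (θ ^ Fintype.card F - θ) * (θ ^ Fintype.card F - θ - algebraMap F K e) = 0 := by
      linear_combination hfrob + hθ - (θ ^ Fintype.card F * θ + algebraMap F K d +
        algebraMap F K e * θ ^ Fintype.card F) * h2
    rcases mul_eq_zero.1 this with h | h
    · exact absurd (sub_eq_zero.1 h) hne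
    · exact sub_eq_zero.1 h
  have hS := sum_one_div_sub_algebraMap hne
  apply (algebraMap F K).injective
  have h1 := congrArg (algebraMap F K) (sum_one_div_quadratic hg 1)
  rw [hsum] at hS
  simp only [pow_one, map_zero] at h1
  have hx : ∀ x : F, algebraMap F K (x / (x ^ 2 + e * x + d)) = 1 / (θ - algebraMap F K x)
      + (θ + algebraMap F K e) * algebraMap F K (1 / (x ^ 2 + e * x + d)) := by
    intro x
    have hmap : algebraMap F K (x ^ 2 + e * x + d)
        = algebraMap F K x ^ 2 + algebraMap F K e * algebraMap F K x + algebraMap F K d := by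
      simp only [map_add, map_mul, map_pow]
    rw [map_div₀, map_div₀, map_one, hmap]
    exact div_quadratic_eq_of_root hθ
      (hmap ▸ (map_ne_zero_iff _ (algebraMap F K).injective).2 (hg x))
  rw [map_sum, Finset.sum_congr rfl fun x _ => hx x, Finset.sum_add_distrib, hS,
    ← Finset.mul_sum, ← map_sum, h1, mul_zero, add_zero, map_div₀, map_one, CharTwo.neg_eq]

theorem injective_add_div_quadratic {F : Type*} [Field F] [CharP F 2] {e d : F}
    (hg : ∀ x : F, x ^ 2 + e * x + d ≠ 0) (c : F) :
    Function.Injective fun x : F => x + c + e ^ 3 / (x ^ 2 + e * x + d) := by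
  intro x y hxy
  by_contra hne
  have hs : x + y ≠ 0 := fun h => hne (CharTwo.add_eq_zero.1 h)
  have h2 : (2 : F) = 0 := CharTwo.two_eq_zero
  apply hg ((x * y + d + e ^ 2 + e * y) / (x + y))
  have hx := hg x
  have hy := hg y
  have key : (x ^ 2 + e * x + d) * (y ^ 2 + e * y + d) + e ^ 3 * (x + y + e) = 0 := by
    apply mul_left_cancel₀ hs
    have h : x + e ^ 3 / (x ^ 2 + e * x + d) = y + e ^ 3 / (y ^ 2 + e * y + d) := by
      linear_combination hxy
    field_simp at h
    grind
  field_simp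
  grind

theorem coeffs_of_injective_add_div_quadratic (hg : ∀ x : F, x ^ 2 + e * x + d ≠ 0) {α β c : F}
    (hαβ : α ≠ 0 ∨ β ≠ 0)
    (hinj : Function.Injective fun x : F => x + c + (α * x + β) / (x ^ 2 + e * x + d)) :
    α = 0 ∧ β = e ^ 3 := by
  have he := linear_coeff_ne_zero hg
  have h2 : (2 : F) = 0 := CharTwo.two_eq_zero
  have hinj' : Function.Injective
      fun x : F => x + (α * x + β) / (x ^ 2 + e * x + d) := by
    intro x y hxy
    apply hinj
    simp only at hxy ⊢
    linear_combination hxy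
  have hsum : ∀ k : ℕ, ∑ x : F, (x + (α * x + β) / (x ^ 2 + e * x + d)) ^ k = ∑ x : F, x ^ k :=
    fun k => (Finite.injective_iff_bijective.1 hinj').sum_comp (· ^ k)
  have hS := sum_div_quadratic hg
  have h1 := sum_one_div_quadratic hg 1
  have hα : α = 0 := by
    have h := hsum 1
    have hx : ∀ x : F, (x + (α * x + β) / (x ^ 2 + e * x + d)) ^ 1
        = x ^ 1 + (α * (x / (x ^ 2 + e * x + d)) + β * (1 / (x ^ 2 + e * x + d) ^ 1)) :=
      fun x => by ring
    rw [Finset.sum_congr rfl fun x _ => hx x, Finset.sum_add_distrib, add_eq_left,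
      Finset.sum_add_distrib, ← Finset.mul_sum, ← Finset.mul_sum, hS, h1] at h
    simpa [he] using h
  subst hα
  refine ⟨rfl, ?_⟩
  replace hαβ : β ≠ 0 := by simpa using hαβ
  have hx2 : ∑ x : F, x ^ 2 / (x ^ 2 + e * x + d) = 1 := by
    have hx : ∀ x : F, x ^ 2 / (x ^ 2 + e * x + d) = 1 + (e * (x / (x ^ 2 + e * x + d))
        + d * (1 / (x ^ 2 + e * x + d) ^ 1)) := by
      intro x
      have hne := hg x
      generalize hG : x ^ 2 + e * x + d = G at hne ⊢
      field_simp
      linear_combination hG - (e * x + d) * h2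
    rw [Finset.sum_congr rfl fun x _ => hx x, Finset.sum_add_distrib,
      Finset.sum_add_distrib, ← Finset.mul_sum, ← Finset.mul_sum, hS, h1]
    simp [he]
  have hxx : e * ∑ x : F, x / (x ^ 2 + e * x + d) ^ 2 = (1 / e) ^ 2 := by
    have hx : ∀ x : F, e * (x / (x ^ 2 + e * x + d) ^ 2) = (x / (x ^ 2 + e * x + d)) ^ 2
        + (1 / (x ^ 2 + e * x + d) ^ 1 + d * (1 / (x ^ 2 + e * x + d) ^ 2)) := by
      intro x
      have hne := hg x
      generalize hG : x ^ 2 + e * x + d = G at hne ⊢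
      field_simp
      linear_combination hG - (x ^ 2 + d) * h2
    rw [Finset.mul_sum, Finset.sum_congr rfl fun x _ => hx x, Finset.sum_add_distrib,
      Finset.sum_add_distrib, ← Finset.mul_sum, h1, sum_one_div_quadratic hg 2, ← CharTwo.sum_sq,
      hS]
    simp
  have h := hsum 3
  have hx : ∀ x : F, (x + (0 * x + β) / (x ^ 2 + e * x + d)) ^ 3
      = x ^ 3 + (β * (x ^ 2 / (x ^ 2 + e * x + d)) + (β ^ 2 * (x / (x ^ 2 + e * x + d) ^ 2)
        + β ^ 3 * (1 / (x ^ 2 + e * x + d) ^ 3))) := by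
    intro x
    generalize x ^ 2 + e * x + d = G
    linear_combination (β * (x ^ 2 / G) + β ^ 2 * (x / G ^ 2)) * h2
  rw [Finset.sum_congr rfl fun x _ => hx x, Finset.sum_add_distrib, add_eq_left,
    Finset.sum_add_distrib, Finset.sum_add_distrib, ← Finset.mul_sum, ← Finset.mul_sum,
    ← Finset.mul_sum, hx2, sum_one_div_quadratic hg 3] at h
  have h' : β * (e ^ 3 + β) = 0 := by
    generalize ∑ x : F, x / (x ^ 2 + e * x + d) ^ 2 = S at hxx h
    field_simp at hxx
    linear_combination e ^ 3 * h - β ^ 2 * hxx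
  have := (mul_eq_zero.1 h').resolve_left hαβ
  exact (CharTwo.add_eq_zero.1 this).symm

theorem injective_cube_iff :
    Function.Injective (fun x : F => x ^ 3) ↔ Fintype.card F % 3 = 2 := by
  classical
  constructor
  · intro h
    obtain ⟨n, -, hn⟩ := FiniteField.card F 2
    have h0 : Fintype.card F % 3 ≠ 0 := by
      rw [hn]
      intro h3
      have := Nat.Prime.dvd_of_dvd_pow Nat.prime_three (Nat.dvd_of_mod_eq_zero h3)
      omega
    by_contra hne
    have hdvd : 3 ∣ Fintype.card Fˣ := by
      rw [Fintype.card_units]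
      omega
    obtain ⟨ω, hω⟩ := exists_prime_orderOf_dvd_card 3 hdvd
    have h1 : (ω : F) = 1 := h (by
      simp only
      rw [← Units.val_pow_eq_pow_val, ← hω, pow_orderOf_eq_one]
      simp)
    rw [Units.val_eq_one.1 h1, orderOf_one] at hω
    omega
  · intro hq
    have key : ∀ x : F, (x ^ 3) ^ ((2 * Fintype.card F - 1) / 3) = x := by
      intro x
      rcases eq_or_ne x 0 with rfl | hx
      · rw [zero_pow three_ne_zero, zero_pow]
        omega
      · rw [← pow_mul]
        have : 3 * ((2 * Fintype.card F - 1) / 3)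
            = (Fintype.card F - 1) + Fintype.card F := by omega
        rw [this, pow_add, FiniteField.pow_card, FiniteField.pow_card_sub_one_eq_one x hx, one_mul]
    exact Function.LeftInverse.injective key

theorem injective_cubic_iff {a b c : F} :
    Function.Injective (fun x : F => x ^ 3 + a * x ^ 2 + b * x + c) ↔
      b = a ^ 2 ∧ Fintype.card F % 3 = 2 := by
  have h2 : (2 : F) = 0 := CharTwo.two_eq_zero
  have hdep : b = a ^ 2 → ((Function.Injective fun x : F => x ^ 3 + a * x ^ 2 + b * x + c) ↔
      Function.Injective fun x : F => x ^ 3) := by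
    rintro rfl
    have : (fun x : F => x ^ 3 + a * x ^ 2 + a ^ 2 * x + c)
        = (Equiv.addRight (c - a ^ 3)) ∘ (fun x => x ^ 3) ∘ Equiv.addRight a := by
      ext x
      simp
      linear_combination -(a * x ^ 2 + a ^ 2 * x) * h2
    rw [this, Equiv.comp_injective, Equiv.injective_comp]
  constructor
  · intro h
    obtain ⟨r, hr⟩ := (Finite.injective_iff_surjective.1 (CharTwo.sq_injective (R := F))) (b + a ^ 2)
    simp only at hr
    have hb : b = a ^ 2 := by
      have h0 : a + r = a := h (by
        simp only
        linear_combination r * hr + (b * r + 2 * a * r ^ 2 + 3 * a ^ 2 * r) * h2)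
      have : r = 0 := by simpa using h0
      rw [this] at hr
      exact CharTwo.add_eq_zero.1 (by simpa using hr.symm)
    exact ⟨hb, injective_cube_iff.1 ((hdep hb).1 h)⟩
  · rintro ⟨hb, hq⟩
    exact (hdep hb).2 (injective_cube_iff.2 hq)

theorem two_mul_ncard_quadratic_no_root :
    2 * {p : F × F | ∀ x : F, x ^ 2 + p.1 * x + p.2 ≠ 0}.ncard
      = Fintype.card F * (Fintype.card F - 1) := by
  classical
  let φ : Sym2 F → F × F := Sym2.lift ⟨fun x y => (x + y, x * y), fun x y => by
    simp only [add_comm, mul_comm]⟩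
  have hφ : Function.Injective φ := by
    intro z w
    induction z with | h a b => ?_
    induction w with | h x y => ?_
    intro h
    obtain ⟨h1, h2⟩ : a + b = x + y ∧ a * b = x * y := by simpa [φ] using h
    have h3 : (a - x) * (a - y) = 0 := by linear_combination a * h1 - h2
    rw [Sym2.eq_iff]
    rcases mul_eq_zero.1 h3 with h4 | h4
    · exact Or.inl ⟨sub_eq_zero.1 h4, by linear_combination h1 - h4⟩
    · exact Or.inr ⟨sub_eq_zero.1 h4, by linear_combination h1 - h4⟩
  have hrange : {p : F × F | ∀ x : F, x ^ 2 + p.1 * x + p.2 ≠ 0} = (Set.range φ)ᶜ := by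
    have htwo : (2 : F) = 0 := CharTwo.two_eq_zero
    ext ⟨s, p⟩
    rw [Set.mem_compl_iff, Set.mem_ofPred_eq, ← not_exists_not, not_iff_not]
    constructor
    · rintro ⟨x, hx⟩
      refine ⟨s(x, x + s), ?_⟩
      have hx' : x ^ 2 + s * x + p = 0 := not_not.1 hx
      simp only [φ, Sym2.lift_mk, Prod.mk.injEq]
      exact ⟨by linear_combination x * htwo, by linear_combination hx' - p * htwo⟩
    · rintro ⟨z, hz⟩
      induction z with | h a b => ?_
      obtain ⟨rfl, rfl⟩ : a + b = s ∧ a * b = p := by simpa [φ] using hz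
      exact ⟨a, not_not.2 (by linear_combination (a ^ 2 + a * b) * htwo)⟩
  have hcard := Set.ncard_add_ncard_compl (Set.range φ)
  rw [← hrange, ← Set.image_univ, Set.ncard_image_of_injective _ hφ, Set.ncard_univ,
    Nat.card_eq_fintype_card, Nat.card_eq_fintype_card, Sym2.card, Fintype.card_prod] at hcard
  have hc := Nat.add_one_mul_choose_eq (Fintype.card F) 1
  rw [Nat.choose_one_right] at hc
  obtain ⟨m, hm⟩ := Nat.exists_eq_succ_of_ne_zero (Fintype.card_ne_zero (α := F))
  rw [hm] at hc hcard ⊢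
  simp only [Nat.succ_eq_add_one, Nat.add_sub_cancel] at hc hcard ⊢
  linarith

end

theorem bijective_ratEval_iff {F : Type} [Field F] [Finite F] {f g : F[X]}
    (h : g.natDegree < f.natDegree) :
    Function.Bijective (ratEval f g) ↔
      (∀ x, g.eval x ≠ 0) ∧ Function.Injective fun x => f.eval x / g.eval x := by
  rw [← Finite.injective_iff_bijective]
  have hnone : ratEval f g none = none := by simp [ratEval, h]
  constructor
  · intro hinj
    have hg : ∀ x, g.eval x ≠ 0 := by
      intro x hx
      have : ratEval f g (some x) = ratEval f g none := by simp [ratEval, hx, h]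
      exact Option.some_ne_none _ (hinj this)
    refine ⟨hg, fun x y hxy => Option.some_injective _ (hinj ?_)⟩
    simpa [ratEval, hg] using hxy
  · rintro ⟨hg, hinj⟩ (_ | x) (_ | y) hxy
    · rfl
    · simp [ratEval, hg, h] at hxy
    · simp [ratEval, hg, h] at hxy
    · rw [hinj (a₁ := x) (a₂ := y) (by simpa [ratEval, hg] using hxy)]

open scoped Classical in
/-- The self-map `t ↦ u + c / t` of the projective line, encoded as `Option F`. -/
def addDivMap {F : Type} [Field F] (u c : F) : Option F → Option F
  | none => some u
  | some t => if t = 0 then none else some (u + c / t)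

theorem injective_addDivMap {F : Type} [Field F] (u : F) {c : F} (hc : c ≠ 0) :
    Function.Injective (addDivMap u c) := by
  rintro (_ | x) (_ | y) hxy
  · rfl
  · by_cases hy : y = 0 <;> simp [addDivMap, hy, hc] at hxy
  · by_cases hx : x = 0 <;> simp [addDivMap, hx, hc] at hxy
  · by_cases hx : x = 0 <;> by_cases hy : y = 0 <;> simp [addDivMap, hx, hy] at hxy
    · rw [hx, hy]
    · rw [div_eq_div_iff hx hy] at hxy
      rw [mul_left_cancel₀ hc hxy]

theorem addDivMap_comp_ratEval {F : Type} [Field F] {f g h : F[X]} {u c : F}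
    (hfg : IsCoprime f g) (hdeg : g.natDegree < f.natDegree)
    (hh : ∀ x, h.eval x = u * f.eval x + c * g.eval x) (hnone : ratEval h f none = some u) :
    ratEval h f = addDivMap u c ∘ ratEval f g := by
  funext x
  rcases x with _ | x
  · rw [hnone, Function.comp_apply]
    simp [ratEval, addDivMap, hdeg]
  · by_cases hg : g.eval x = 0
    · have hf : f.eval x ≠ 0 := by
        intro hf
        obtain ⟨a, b, hab⟩ := hfg
        simpa [hf, hg] using congrArg (eval x) hab
      simp [ratEval, addDivMap, hg, hf, hh]
    · by_cases hf : f.eval x = 0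
      · simp [ratEval, addDivMap, hg, hf]
      · simp only [ratEval, addDivMap, Function.comp_apply, hg, hf, hh, ne_eq, not_false_eq_true,
          if_true, div_eq_zero_iff, or_self, if_false, Option.some.injEq]
        field_simp

theorem bijective_ratEval_swap_iff {F : Type} [Field F] [Finite F] {f g : F[X]}
    (hfg : IsCoprime f g) (hdeg : g.natDegree < f.natDegree) :
    Function.Bijective (ratEval g f) ↔ Function.Bijective (ratEval f g) := by
  rw [addDivMap_comp_ratEval (u := 0) (c := 1) hfg hdeg (by simp)
    (by simp [ratEval, hdeg, hdeg.not_gt]),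
    Function.Bijective.of_comp_iff'
      (Finite.injective_iff_bijective.1 (injective_addDivMap 0 one_ne_zero))]

theorem bijective_ratEval_add_C_mul_iff {F : Type} [Field F] [Finite F] {f g : F[X]} {c : F}
    (hf : f.Monic) (hfg : IsCoprime f g) (hdeg : g.natDegree < f.natDegree) (hc : c ≠ 0) :
    Function.Bijective (ratEval (f + C c * g) f) ↔ Function.Bijective (ratEval f g) := by
  have hlt : (C c * g).natDegree < f.natDegree := (natDegree_C_mul_le c g).trans_lt hdeg
  have hmonic : (f + C c * g).Monic := hf.add_of_left (degree_lt_degree hlt)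
  have hnat : (f + C c * g).natDegree = f.natDegree := natDegree_add_eq_left_of_natDegree_lt hlt
  rw [addDivMap_comp_ratEval (u := 1) (c := c) hfg hdeg (by simp)
    (by simp [ratEval, hnat, hf.leadingCoeff, hmonic.leadingCoeff]),
    Function.Bijective.of_comp_iff'
      (Finite.injective_iff_bijective.1 (injective_addDivMap 1 hc))]

/-- The pairs in `permPairs F` whose quotient fixes the point at infinity. -/
def permPairsFixingInfty (F : Type) [Field F] : Set (F[X] × F[X]) :=
  {p | p ∈ permPairs F ∧ p.2.natDegree < p.1.natDegree}

theorem mem_permPairsFixingInfty_iff {F : Type} [Field F] [Finite F] {f g : F[X]} :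
    (f, g) ∈ permPairsFixingInfty F ↔ f.Monic ∧ g.Monic ∧ IsCoprime f g ∧ f.natDegree = 3 ∧
      g.natDegree < 3 ∧ (∀ x, g.eval x ≠ 0) ∧
        Function.Injective fun x => f.eval x / g.eval x := by
  constructor
  · rintro ⟨⟨h1, h2, h3, h4, h5⟩, h6⟩
    simp only at h1 h2 h3 h4 h5 h6
    rw [bijective_ratEval_iff h6] at h5
    exact ⟨h1, h2, h3, by omega, by omega, h5⟩
  · rintro ⟨h1, h2, h3, h4, h5, h6⟩
    have hlt : g.natDegree < f.natDegree := by omega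
    exact ⟨⟨h1, h2, h3, by simp only; omega, (bijective_ratEval_iff hlt).2 h6⟩, hlt⟩

open scoped Classical in
/-- The left translates of `f / g` by representatives of the stabilizer of infinity: `f / g`
itself, `g / f`, and `1 + c g / f` for `c ≠ 0`. -/
def leftTranslate {F : Type} [Field F] : (F[X] × F[X]) × Option F → F[X] × F[X]
  | (p, none) => p
  | (p, some c) => if c = 0 then (p.2, p.1) else (p.1 + C c * p.2, p.1)

theorem permPairs_eq_image_leftTranslate (F : Type) [Field F] [Finite F] :
    permPairs F = leftTranslate '' (permPairsFixingInfty F ×ˢ Set.univ) := by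
  ext ⟨f, g⟩
  constructor
  · intro hp
    have hp' := hp
    obtain ⟨hf, hg, hfg, hmax, hbij⟩ := hp'
    simp only at hf hg hfg hmax hbij
    rcases lt_trichotomy g.natDegree f.natDegree with h | h | h
    · exact ⟨((f, g), none), ⟨⟨hp, h⟩, trivial⟩, rfl⟩
    · have hne : f - g ≠ 0 := by
        intro h0
        rw [sub_eq_zero.1 h0, isCoprime_self] at hfg
        have := natDegree_eq_zero_of_isUnit hfg
        omega
      have hlt : (f - g).degree < g.degree := by
        refine (degree_sub_lt_left ?_ hf.ne_zero (by rw [hf.leadingCoeff, hg.leadingCoeff])).trans_le ?_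
        · rw [degree_eq_natDegree hf.ne_zero, degree_eq_natDegree hg.ne_zero, h]
        · rw [degree_eq_natDegree hf.ne_zero, degree_eq_natDegree hg.ne_zero, h]
      set c := (f - g).leadingCoeff with hc
      have hc0 : c ≠ 0 := leadingCoeff_ne_zero.2 hne
      set k := C c⁻¹ * (f - g) with hk
      have hfk : f = g + C c * k := by
        rw [hk, ← mul_assoc, ← C_mul, mul_inv_cancel₀ hc0, C_1, one_mul, add_sub_cancel]
      have hkm : k.Monic := by
        rw [Monic, hk, leadingCoeff_mul, leadingCoeff_C, ← hc, inv_mul_cancel₀ hc0]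
      have hklt : k.natDegree < g.natDegree := by
        rw [hk, natDegree_C_mul (inv_ne_zero hc0)]
        exact natDegree_lt_natDegree hne hlt
      have hgk : IsCoprime g k := by
        have hu : IsUnit (C c) := isUnit_C.2 hc0.isUnit
        rw [hfk, add_comm] at hfg
        have := IsCoprime.of_add_mul_right_left (x := C c * k) (y := g) (z := 1) (by rwa [one_mul])
        exact (isCoprime_mul_unit_left_left hu k g).1 this |>.symm
      rw [hfk, bijective_ratEval_add_C_mul_iff hg hgk hklt hc0] at hbij
      refine ⟨((g, k), some c), ⟨⟨⟨hg, hkm, hgk, by simp only; omega, hbij⟩, hklt⟩, trivial⟩, ?_⟩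
      simp only [leftTranslate, hc0, if_false]
      rw [← hfk]
    · refine ⟨((g, f), some 0), ⟨⟨⟨hg, hf, hfg.symm, by rwa [max_comm], ?_⟩, h⟩, trivial⟩, ?_⟩
      · exact (bijective_ratEval_swap_iff hfg.symm h).1 hbij
      · simp [leftTranslate]
  · rintro ⟨⟨⟨f, g⟩, c⟩, ⟨⟨⟨hf, hg, hfg, hmax, hbij⟩, hlt⟩, -⟩, heq⟩
    simp only at hf hg hfg hmax hbij hlt
    rw [← heq]
    rcases c with _ | c
    · exact ⟨hf, hg, hfg, hmax, hbij⟩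
    · by_cases hc : c = 0
      · simp only [leftTranslate, hc, if_true]
        exact ⟨hg, hf, hfg.symm, by rwa [max_comm], (bijective_ratEval_swap_iff hfg hlt).2 hbij⟩
      · simp only [leftTranslate, hc, if_false]
        have hlt' : (C c * g).natDegree < f.natDegree := (natDegree_C_mul_le c g).trans_lt hlt
        refine ⟨hf.add_of_left (degree_lt_degree hlt'), hf, ?_, ?_,
          (bijective_ratEval_add_C_mul_iff hf hfg hlt hc).2 hbij⟩
        · have hu : IsUnit (C c) := isUnit_C.2 (Ne.isUnit hc)
          have := (isCoprime_mul_unit_left_left hu g f).2 hfg.symm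
          simpa [add_comm] using this.add_mul_right_left 1
        · simp only
          rw [natDegree_add_eq_left_of_natDegree_lt hlt']
          omega

theorem injOn_leftTranslate (F : Type) [Field F] :
    Set.InjOn leftTranslate (permPairsFixingInfty F ×ˢ (Set.univ : Set (Option F))) := by
  have hdeg : ∀ {f g : F[X]} (c : F), g.natDegree < f.natDegree →
      (f + C c * g).natDegree = f.natDegree := fun c hlt =>
    natDegree_add_eq_left_of_natDegree_lt ((natDegree_C_mul_le c _).trans_lt hlt)
  rintro ⟨⟨f, g⟩, c⟩ ⟨⟨⟨hf, hg, hfg, hmax, hbij⟩, hlt⟩, -⟩ ⟨⟨f', g'⟩, c'⟩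
    ⟨⟨⟨hf', hg', hfg', hmax', hbij'⟩, hlt'⟩, -⟩ heq
  simp only at hf hg hlt hf' hg' hlt'
  rcases c with _ | c <;> rcases c' with _ | c'
  · simpa [leftTranslate] using heq
  · by_cases hc' : c' = 0
    · simp only [leftTranslate, hc', if_true, Prod.mk.injEq] at heq
      rw [heq.1, heq.2] at hlt
      omega
    · simp only [leftTranslate, hc', if_false, Prod.mk.injEq] at heq
      rw [heq.1, heq.2, hdeg c' hlt'] at hlt
      omega
  · by_cases hc : c = 0
    · simp only [leftTranslate, hc, if_true, Prod.mk.injEq] at heq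
      rw [heq.1, heq.2] at hlt
      omega
    · simp only [leftTranslate, hc, if_false, Prod.mk.injEq] at heq
      rw [← heq.1, ← heq.2, hdeg c hlt] at hlt'
      omega
  · by_cases hc : c = 0 <;> by_cases hc' : c' = 0
    · simp only [leftTranslate, hc, hc', if_true, Prod.mk.injEq] at heq
      rw [hc, hc', heq.1, heq.2]
    · simp only [leftTranslate, hc, hc', if_true, if_false, Prod.mk.injEq] at heq
      rw [heq.1, heq.2, hdeg c' hlt'] at hlt
      omega
    · simp only [leftTranslate, hc, hc', if_true, if_false, Prod.mk.injEq] at heq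
      rw [← heq.1, ← heq.2, hdeg c hlt] at hlt'
      omega
    · simp only [leftTranslate, hc, hc', if_false, Prod.mk.injEq] at heq
      obtain ⟨h1, rfl⟩ := heq
      have h2 : C c * g = C c' * g' := add_left_cancel h1
      have h3 : c = c' := by
        have := congrArg leadingCoeff h2
        simpa [hg.leadingCoeff, hg'.leadingCoeff] using this
      subst h3
      rw [mul_left_cancel₀ (C_ne_zero.2 hc) h2]

theorem ncard_permPairs (F : Type) [Field F] [Fintype F] :
    (permPairs F).ncard = (permPairsFixingInfty F).ncard * (Fintype.card F + 1) := by
  rw [permPairs_eq_image_leftTranslate, (injOn_leftTranslate F).ncard_image,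
    Set.ncard_prod, Set.ncard_univ, Nat.card_eq_fintype_card, Fintype.card_option]

/-- The pair with quotient `x + c + e ^ 3 / (x ^ 2 + e x + d)`. -/
def quadraticPair {F : Type} [Field F] (p : (F × F) × F) : F[X] × F[X] :=
  ((X + C p.2) * (X ^ 2 + C p.1.1 * X + C p.1.2) + C (p.1.1 ^ 3), X ^ 2 + C p.1.1 * X + C p.1.2)

/-- The pair with quotient the cubic polynomial `x ^ 3 + a x ^ 2 + a ^ 2 x + c`. -/
def cubicPair {F : Type} [Field F] (p : F × F) : F[X] × F[X] :=
  (X ^ 3 + C p.1 * X ^ 2 + C (p.1 ^ 2) * X + C p.2, 1)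

theorem injective_quadraticPair {F : Type} [Field F] :
    Function.Injective (quadraticPair (F := F)) := by
  rintro ⟨⟨e, d⟩, c⟩ ⟨⟨e', d'⟩, c'⟩ h
  simp only [quadraticPair, Prod.mk.injEq] at h
  obtain ⟨h1, h2⟩ := h
  have hd : d = d' := by simpa using congrArg (eval 0) h2
  have he : e = e' := by simpa [hd] using congrArg (eval 1) h2
  subst hd he
  have hne : (X ^ 2 + C e * X + C d : F[X]) ≠ 0 := by
    have : (X ^ 2 + C e * X + C d : F[X]).Monic := by monicity!
    exact this.ne_zero
  have hc := mul_right_cancel₀ hne (add_right_cancel h1)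
  have hc : c = c' := by simpa using hc
  rw [hc]

theorem injective_cubicPair {F : Type} [Field F] :
    Function.Injective (cubicPair (F := F)) := by
  rintro ⟨a, c⟩ ⟨a', c'⟩ h
  simp only [cubicPair, Prod.mk.injEq, and_true] at h
  have hc : c = c' := by simpa using congrArg (coeff · 0) h
  have ha : a = a' := by simpa [coeff_X, coeff_C, coeff_one, -map_pow] using congrArg (coeff · 2) h
  rw [ha, hc]

theorem quadraticPair_mem {F : Type} [Field F] [Finite F] [CharP F 2] {e d c : F}
    (hg : ∀ x : F, x ^ 2 + e * x + d ≠ 0) :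
    quadraticPair ((e, d), c) ∈ permPairsFixingInfty F := by
  cases nonempty_fintype F
  have he := linear_coeff_ne_zero hg
  refine mem_permPairsFixingInfty_iff.2 ⟨by monicity!, by monicity!, ?_, by compute_degree!, ?_,
    by simpa using hg, ?_⟩
  · have hu : IsCoprime (C (e ^ 3)) (X ^ 2 + C e * X + C d) := by
      have hunit : IsUnit (C (e ^ 3)) := isUnit_C.2 (pow_ne_zero 3 he).isUnit
      simpa only [mul_one] using
        (isCoprime_mul_unit_left_left hunit 1 (X ^ 2 + C e * X + C d)).2 isCoprime_one_left
    have h := hu.add_mul_right_left (X + C c)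
    rwa [add_comm] at h
  · have : (X ^ 2 + C e * X + C d : F[X]).natDegree = 2 := by compute_degree!
    simp only
    omega
  · convert! injective_add_div_quadratic hg c using 2 with x
    simp [add_div, mul_div_cancel_right₀ _ (hg x)]

theorem mem_permPairsFixingInfty_one_iff {F : Type} [Field F] [Fintype F] [CharP F 2] {f : F[X]} :
    (f, 1) ∈ permPairsFixingInfty F ↔
      Fintype.card F % 3 = 2 ∧ (f, 1) ∈ Set.range (cubicPair (F := F)) := by
  constructor
  · intro h
    obtain ⟨hf, -, -, hdeg, -, -, hinj⟩ := mem_permPairsFixingInfty_iff.1 h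
    have hfe : f = X ^ 3 + C (f.coeff 2) * X ^ 2 + C (f.coeff 1) * X + C (f.coeff 0) := by
      conv_lhs => rw [f.as_sum_range_C_mul_X_pow, hdeg]
      have h3 : f.coeff 3 = 1 := by rw [← hdeg]; exact hf
      simp only [Finset.sum_range_succ, Finset.sum_range_zero, h3]
      simp
      ring
    have hinj' : Function.Injective fun x : F =>
        x ^ 3 + f.coeff 2 * x ^ 2 + f.coeff 1 * x + f.coeff 0 := by
      convert hinj using 2 with x
      conv_rhs => rw [hfe]
      simp
    obtain ⟨hb, hq⟩ := injective_cubic_iff.1 hinj'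
    refine ⟨hq, (f.coeff 2, f.coeff 0), ?_⟩
    simp only [cubicPair, Prod.mk.injEq, and_true]
    rw [← hb]
    exact hfe.symm
  · rintro ⟨hq, ⟨a, c⟩, h⟩
    simp only [cubicPair, Prod.mk.injEq, and_true] at h
    subst h
    refine mem_permPairsFixingInfty_iff.2 ⟨by monicity!, monic_one, isCoprime_one_right,
      by compute_degree!, by simp, by simp, ?_⟩
    simpa using injective_cubic_iff.2 ⟨rfl, hq⟩

theorem permPairsFixingInfty_eq (F : Type) [Field F] [Fintype F] [CharP F 2] :
    permPairsFixingInfty F =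
      quadraticPair '' ({p : F × F | ∀ x : F, x ^ 2 + p.1 * x + p.2 ≠ 0} ×ˢ Set.univ) ∪
        {p | Fintype.card F % 3 = 2 ∧ p ∈ Set.range (cubicPair (F := F))} := by
  ext ⟨f, g⟩
  constructor
  · intro h
    obtain ⟨hf, hg, hfg, hdeg, hgdeg, hroot, hinj⟩ := mem_permPairsFixingInfty_iff.1 h
    have hf3 : f.coeff 3 = 1 := by rw [← hdeg]; exact hf
    have hgm : g.coeff g.natDegree = 1 := hg
    have hge := g.as_sum_range_C_mul_X_pow
    interval_cases hgn : g.natDegree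
    · right
      obtain rfl : g = 1 := hg.natDegree_eq_zero.1 hgn
      exact mem_permPairsFixingInfty_one_iff.1 h
    · exfalso
      simp only [Finset.sum_range_succ, Finset.sum_range_zero, hgm] at hge
      apply hroot (-g.coeff 0)
      rw [hge]
      simp
    · left
      set e := g.coeff 1
      set d := g.coeff 0
      replace hge : g = X ^ 2 + C e * X + C d := by
        simp only [Finset.sum_range_succ, Finset.sum_range_zero, hgm] at hge
        rw [hge]
        simp
        ring
      set c := f.coeff 2 - e
      set α := f.coeff 1 - d - c * e
      set β := f.coeff 0 - c * d
      have hfe : f = (X + C c) * g + (C α * X + C β) := by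
        conv_lhs => rw [f.as_sum_range_C_mul_X_pow, hdeg]
        simp only [Finset.sum_range_succ, Finset.sum_range_zero, hf3, hge, α, β, c, map_sub,
          map_mul, C_1]
        ring
      clear_value e d c α β
      have hroot' : ∀ x : F, x ^ 2 + e * x + d ≠ 0 := fun x => by simpa [hge] using hroot x
      have hαβ : α ≠ 0 ∨ β ≠ 0 := by
        by_contra! h0
        rw [h0.1, h0.2] at hfe
        have hu : IsUnit g := hfg.isUnit_of_dvd' ⟨X + C c, by rw [hfe]; simp [mul_comm]⟩ dvd_rfl
        have := natDegree_eq_zero_of_isUnit hu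
        omega
      have hinj' : Function.Injective
          fun x : F => x + c + (α * x + β) / (x ^ 2 + e * x + d) := by
        convert hinj using 2 with x
        rw [hfe, hge]
        simp only [eval_add, eval_mul, eval_pow, eval_X, eval_C]
        rw [add_div _ (α * x + β), mul_div_cancel_right₀ _ (hroot' x)]
      obtain ⟨rfl, rfl⟩ := coeffs_of_injective_add_div_quadratic hroot' hαβ hinj'
      refine ⟨((e, d), c), ⟨hroot', trivial⟩, ?_⟩
      rw [quadraticPair, hfe, hge]
      simp
  · rintro (⟨⟨⟨e, d⟩, c⟩, ⟨hg, -⟩, h⟩ | ⟨hq, ⟨p, hp⟩⟩)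
    · rw [← h]
      exact quadraticPair_mem hg
    · obtain rfl : 1 = g := congrArg Prod.snd hp
      exact mem_permPairsFixingInfty_one_iff.2 ⟨hq, p, hp⟩

theorem two_mul_ncard_permPairsFixingInfty (F : Type) [Field F] [Fintype F] [CharP F 2] :
    2 * (permPairsFixingInfty F).ncard = Fintype.card F ^ 2 * (Fintype.card F - 1) +
      if Fintype.card F % 3 = 2 then 2 * Fintype.card F ^ 2 else 0 := by
  have hdisj : Disjoint
      (quadraticPair '' ({p : F × F | ∀ x : F, x ^ 2 + p.1 * x + p.2 ≠ 0} ×ˢ Set.univ))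
      {p | Fintype.card F % 3 = 2 ∧ p ∈ Set.range (cubicPair (F := F))} := by
    rw [Set.disjoint_left]
    rintro _ ⟨⟨⟨e, d⟩, c⟩, -, rfl⟩ ⟨-, ⟨p, hp⟩⟩
    have h := congrArg (fun p => natDegree p.2) hp
    have hdeg : (X ^ 2 + C e * X + C d : F[X]).natDegree = 2 := by compute_degree!
    simp [cubicPair, quadraticPair, hdeg] at h
  have hquad := two_mul_ncard_quadratic_no_root (F := F)
  have hcubic : {p | Fintype.card F % 3 = 2 ∧ p ∈ Set.range (cubicPair (F := F))}.ncard
      = if Fintype.card F % 3 = 2 then Fintype.card F ^ 2 else 0 := by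
    split_ifs with hq
    · simp only [hq, true_and, Set.ofPred_mem_eq]
      rw [← Set.image_univ, Set.ncard_image_of_injective _ injective_cubicPair, Set.ncard_univ,
        Nat.card_eq_fintype_card, Fintype.card_prod, sq]
    · simp [hq]
  have hfin : (permPairsFixingInfty F).Finite := by
    rw [permPairsFixingInfty_eq]
    exact (Set.toFinite _).union ((Set.finite_range _).subset fun p hp => hp.2)
  rw [permPairsFixingInfty_eq] at hfin ⊢
  rw [Set.ncard_union_eq hdisj (hfin.subset Set.subset_union_left)
    (hfin.subset Set.subset_union_right), hcubic,
    Set.ncard_image_of_injective _ injective_quadraticPair, Set.ncard_prod, Set.ncard_univ,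
    Nat.card_eq_fintype_card, mul_add, ← mul_assoc, hquad]
  split_ifs <;> ring

theorem stmt_15 (F : Type) [Field F] [Fintype F] (n : ℕ) (hn : 0 < n)
    (hq : Fintype.card F = 2 ^ n) :
    (2 * (permPairs F).ncard : ℤ) =
      (Fintype.card F : ℤ) ^ 4 +
        2 * ((Fintype.card F : ℤ) % 3 - 1) * (Fintype.card F : ℤ) ^ 3 +
        (2 * ((Fintype.card F : ℤ) % 3) - 3) * (Fintype.card F : ℤ) ^ 2 := by
  have htwo : (2 : F) = 0 := by
    have h : ((2 ^ n : ℕ) : F) = 0 := by rw [← hq, Nat.cast_card_eq_zero]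
    exact pow_eq_zero_iff hn.ne' |>.1 (by simpa using h)
  have : CharP F 2 := CharTwo.of_one_ne_zero_of_two_eq_zero one_ne_zero htwo
  have hA := two_mul_ncard_permPairsFixingInfty F
  have h3 : Fintype.card F % 3 ≠ 0 := by
    rw [hq]
    intro h
    have := Nat.Prime.dvd_of_dvd_pow Nat.prime_three (Nat.dvd_of_mod_eq_zero h)
    omega
  have hpos : 1 ≤ Fintype.card F := Fintype.card_pos
  rw [ncard_permPairs]
  generalize (permPairsFixingInfty F).ncard = A at hA ⊢
  generalize Fintype.card F = q at hA h3 hpos ⊢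
  zify [hpos] at hA
  push_cast
  split_ifs at hA with h
  · have hm : (q : ℤ) % 3 = 2 := by omega
    rw [hm]
    linear_combination ((q : ℤ) + 1) * hA
  · have hm : (q : ℤ) % 3 = 1 := by omega
    rw [hm]
    linear_combination ((q : ℤ) + 1) * hA

end
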